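/- Let p, q be integers with p ≡ 0 (mod 2) and q ≡ 1 (mod 2), and let n ≥ 1. Then the generalized Fibonacci–Lucas quaternion G^{p,q}_n is a zero divisor in H[Z_2] (equivalently, not a unit) if and only if n ≡ 0 (mod 3). -/

import Mathlib

open Quaternion

/-- The Lucas sequence, as integers: `l_n = 2·f_{n+1} - f_n`
(equivalently `l_0 = 2`, `l_1 = 1`, `l_{n+2} = l_{n+1} + l_n`). -/
def lucas (n : ℕ) : ℤ := 2 * (Nat.fib (n + 1) : ℤ) - (Nat.fib n : ℤ)

/-- The generalized Fibonacci–Lucas numbers `g^{p,q}_n = p·f_{n-1} + q·l_n` (for `n ≥ 1`). -/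
def genFL (p q : ℤ) (n : ℕ) : ℤ := p * (Nat.fib (n - 1) : ℤ) + q * lucas n

/-- The n-th generalized Fibonacci–Lucas quaternion over a commutative ring `R`:
`G^{p,q}_n = g^{p,q}_n + g^{p,q}_{n+1}·i + g^{p,q}_{n+2}·j + g^{p,q}_{n+3}·k` in `ℍ[R]`. -/
def genFLQuat (R : Type*) [CommRing R] (p q : ℤ) (n : ℕ) : ℍ[R] :=
  ⟨(genFL p q n : R), (genFL p q (n + 1) : R), (genFL p q (n + 2) : R), (genFL p q (n + 3) : R)⟩

theorem Quaternion.isUnit_iff_isUnit_normSq {R : Type*} [CommRing R] (a : ℍ[R]) :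
    IsUnit a ↔ IsUnit (normSq a) := by
  refine ⟨fun h => h.map normSq, fun h => ?_⟩
  have hu : IsUnit ((normSq a : R) : ℍ[R]) := h.map (algebraMap R ℍ[R])
  have hc : Commute a (star a) := (Quaternion.self_mul_star a).trans (Quaternion.star_mul_self a).symm
  rw [← Quaternion.self_mul_star] at hu
  exact (hc.isUnit_mul_iff.1 hu).1

theorem genFL_intCast_zmod_two {p q : ℤ} (hp : p % 2 = 0) (hq : q % 2 = 1) (n : ℕ) :
    (genFL p q n : ZMod 2) = (Nat.fib n : ZMod 2) := by
  have hp' : (p : ZMod 2) = 0 := (ZMod.intCast_zmod_eq_zero_iff_dvd p 2).2 (by omega)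
  have hq' : (q : ZMod 2) = 1 := by
    have := (ZMod.intCast_eq_intCast_iff q 1 2).2 hq
    simpa using this
  have h2 : (2 : ZMod 2) = 0 := rfl
  simp [genFL, lucas, hp', hq', h2, ZMod.neg_eq_self_mod_two]

theorem Nat.even_fib_iff (n : ℕ) : Even (Nat.fib n) ↔ 3 ∣ n := by
  rw [even_iff_two_dvd]
  have h3 : Nat.fib 3 = 2 := rfl
  constructor
  · intro h
    have hg : Nat.fib (Nat.gcd 3 n) = 2 := by
      rw [Nat.fib_gcd, h3, Nat.gcd_eq_left h]
    rcases (Nat.dvd_prime Nat.prime_three).1 (Nat.gcd_dvd_left 3 n) with h' | h'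
    · simp [h'] at hg
    · exact Nat.gcd_eq_left_iff_dvd.1 h'
  · intro h
    simpa [h3] using Nat.fib_dvd 3 n h

theorem normSq_genFLQuat_zmod_two {p q : ℤ} (hp : p % 2 = 0) (hq : q % 2 = 1) (n : ℕ) :
    normSq (genFLQuat (ZMod 2) p q n) = (Nat.fib n : ZMod 2) := by
  rw [Quaternion.normSq_def']
  simp only [genFLQuat, genFL_intCast_zmod_two hp hq]
  have h1 : Nat.fib (n + 3) = Nat.fib (n + 1) + Nat.fib (n + 2) := Nat.fib_add_two
  rw [h1, Nat.fib_add_two (n := n)]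
  push_cast
  generalize (Nat.fib n : ZMod 2) = a
  generalize (Nat.fib (n + 1) : ZMod 2) = b
  decide +revert

theorem genFLQuat_zmod_two_even_odd (p q : ℤ) (hp : p % 2 = 0) (hq : q % 2 = 1)
    (n : ℕ) (hn : 1 ≤ n) :
    ¬ IsUnit (genFLQuat (ZMod 2) p q n) ↔ n % 3 = 0 := by
  rw [Quaternion.isUnit_iff_isUnit_normSq, normSq_genFLQuat_zmod_two hp hq, isUnit_iff_ne_zero,
    not_not, ZMod.natCast_eq_zero_iff_even, Nat.even_fib_iff, Nat.dvd_iff_mod_eq_zero]
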